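/- Let α ∈ (0,1). Let G : ℝ² → ℝ have finite parabolic Hölder seminorm [G]_α and be twice differentiable in x₁ away from {x₂ = 0} with |∂₁^k G(x)| ≤ C(G)·|x₂|^{(α−k)/2} for k = 1, 2. For i = 0, 1 let F_i : ℝ² → ℝ be bounded with [F_i]_α < ∞. Then, with Comm_T^{F}(x) := G(x)·(F * ∂₁²ψ_T)(x) − ((F·G) * ∂₁²ψ_T)(x) + 2·((F·∂₁G) * ∂₁ψ_T)(x) − ((F·∂₁²G) * ψ_T)(x), there is a constant C(α) such that for all T ∈ (0,1] and x ∈ ℝ²: |Comm_T^{F_0}(x) − Comm_T^{F_1}(x)| ≤ C(α) · (C(G) + [G]_α) · [F_0 − F_1]_α · T^{(2α−2)/4}. -/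

import Mathlib

open MeasureTheory

/-- The parabolic distance on `ℝ²`. -/
noncomputable def pdist (x y : ℝ × ℝ) : ℝ := |x.1 - y.1| + Real.sqrt |x.2 - y.2|

/-- Partial derivative in the first (space-like) variable. -/
noncomputable def pd1 (f : ℝ × ℝ → ℝ) : ℝ × ℝ → ℝ := fun x => deriv (fun s => f (s, x.2)) x.1

/-- Partial derivative in the second (time-like) variable. -/
noncomputable def pd2 (f : ℝ × ℝ → ℝ) : ℝ × ℝ → ℝ := fun x => deriv (fun s => f (x.1, s)) x.2

def IsPsiKernel (ψ : ℝ → ℝ × ℝ → ℝ) : Prop :=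
  (∀ T : ℝ, 0 < T → ∃ φ : SchwartzMap (ℝ × ℝ) ℝ, ψ T = ⇑φ) ∧
  (∃ C : ℝ, ∀ T : ℝ, 0 < T → ∀ k : ℝ × ℝ,
      (∫ x : ℝ × ℝ,
          Complex.exp (-(2 * Real.pi * (k.1 * x.1 + k.2 * x.2) : ℝ) * Complex.I) * (ψ T x : ℂ))
        = (C : ℂ) * Complex.exp ((-(T * (k.1 ^ 4 + k.2 ^ 2)) : ℝ) : ℂ)) ∧
  (∫ x : ℝ × ℝ, |ψ 1 x|) = 1

/-- The renormalized commutator `[G, (·)_T] ◊ ∂₁²F` associated with the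
generalized product `G ◊ ∂₁²F := ∂₁²(FG) - 2∂₁(F·∂₁G) + F·∂₁²G`. -/
noncomputable def commT (ψ : ℝ → ℝ × ℝ → ℝ) (T : ℝ) (F G : ℝ × ℝ → ℝ) (x : ℝ × ℝ) : ℝ :=
  G x * (∫ y : ℝ × ℝ, F y * pd1 (pd1 (ψ T)) (x - y))
    - (∫ y : ℝ × ℝ, (F y * G y) * pd1 (pd1 (ψ T)) (x - y))
    + 2 * (∫ y : ℝ × ℝ, (F y * pd1 G y) * pd1 (ψ T) (x - y))
    - (∫ y : ℝ × ℝ, (F y * pd1 (pd1 G) y) * ψ T (x - y))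

/-- A Schwartz function decays faster than the reciprocal of the parabolic weight. -/
theorem SchwartzMap.exists_parabolic_decay (φ : SchwartzMap (ℝ × ℝ) ℝ) :
    ∃ M : ℝ, 0 ≤ M ∧ ∀ z : ℝ × ℝ, |φ z| * (1 + (|z.1| + √|z.2|)) ^ 2
      ≤ M * ((1 + z.1 ^ 2)⁻¹ * (1 + z.2 ^ 2)⁻¹) := by
  obtain ⟨C, hC0, hC⟩ := φ.decay 0 0
  obtain ⟨D, hD0, hD⟩ := φ.decay 6 0
  refine ⟨256 * (C + D), by positivity, fun z => ?_⟩
  have h0 := hC z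
  have h6 := hD z
  simp only [pow_zero, one_mul, norm_iteratedFDeriv_zero, Real.norm_eq_abs] at h0 h6
  set r := ‖z‖ with hr
  have hr0 : 0 ≤ r := norm_nonneg z
  have h1 : |z.1| ≤ r := norm_fst_le z
  have h2 : |z.2| ≤ r := norm_snd_le z
  have hs : √|z.2| ≤ 1 + r := by
    rw [Real.sqrt_le_left (by positivity)]
    nlinarith
  have e1 : 1 + z.1 ^ 2 ≤ (1 + r) ^ 2 := by
    rw [← sq_abs]
    nlinarith [abs_nonneg z.1]
  have e2 : 1 + z.2 ^ 2 ≤ (1 + r) ^ 2 := by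
    rw [← sq_abs]
    nlinarith [abs_nonneg z.2]
  have e3 : (1 + (|z.1| + √|z.2|)) ^ 2 ≤ 4 * (1 + r) ^ 2 := by
    have : 1 + (|z.1| + √|z.2|) ≤ 2 * (1 + r) := by linarith
    calc (1 + (|z.1| + √|z.2|)) ^ 2 ≤ (2 * (1 + r)) ^ 2 := by gcongr
      _ = _ := by ring
  have e4 : (1 + r) ^ 6 ≤ 2 ^ 5 * (1 + r ^ 6) := by
    simpa using add_pow_le (zero_le_one) hr0 6
  rw [← mul_inv, ← div_eq_mul_inv, le_div_iff₀ (by positivity)]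
  calc |φ z| * (1 + (|z.1| + √|z.2|)) ^ 2 * ((1 + z.1 ^ 2) * (1 + z.2 ^ 2))
      ≤ |φ z| * (4 * (1 + r) ^ 2) * ((1 + r) ^ 2 * (1 + r) ^ 2) := by gcongr
    _ = 4 * |φ z| * (1 + r) ^ 6 := by ring
    _ ≤ 4 * |φ z| * (2 ^ 5 * (1 + r ^ 6)) := by gcongr
    _ = 128 * (|φ z| + r ^ 6 * |φ z|) := by ring
    _ ≤ 128 * (C + D) := by gcongr
    _ ≤ 256 * (C + D) := by linarith

theorem integral_inv_one_add_sub_div_sq {m : ℝ} (hm : 0 < m) (c : ℝ) :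
    Integrable (fun s : ℝ => (1 + ((c - s) / m) ^ 2)⁻¹) ∧
      ∫ s : ℝ, (1 + ((c - s) / m) ^ 2)⁻¹ = m * Real.pi := by
  constructor
  · exact (integrable_inv_one_add_sq.comp_div hm.ne').comp_sub_left c
  · rw [integral_sub_left_eq_self (fun s : ℝ => (1 + (s / m) ^ 2)⁻¹) volume c,
      Measure.integral_comp_div (fun s : ℝ => (1 + s ^ 2)⁻¹) m, abs_of_pos hm]
    simp

theorem integrableOn_abs_rpow {β : ℝ} (hβ : -1 < β) {m : ℝ} (hm : 0 < m) :
    IntegrableOn (fun s : ℝ => |s| ^ β) (Set.Icc (-m) m) ∧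
      ∫ s in Set.Icc (-m) m, |s| ^ β = 2 / (1 + β) * m ^ (1 + β) := by
  have hI (a b : ℝ) : IntervalIntegrable (fun s : ℝ => |s| ^ β) volume a b := by
    have hpos : ∀ b : ℝ, 0 ≤ b → IntervalIntegrable (fun s : ℝ => |s| ^ β) volume 0 b := by
      intro b hb
      refine (intervalIntegral.intervalIntegrable_rpow' hβ (a := 0) (b := b)).congr ?_
      intro s hs
      rw [Set.uIoc_of_le hb] at hs
      simp [abs_of_pos hs.1]
    have h0 : ∀ b : ℝ, IntervalIntegrable (fun s : ℝ => |s| ^ β) volume 0 b := by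
      intro b
      rcases le_total 0 b with hb | hb
      · exact hpos b hb
      · have := (hpos (-b) (by linarith)).comp_sub_left 0
        simpa using this
    exact (h0 a).symm.trans (h0 b)
  have hle : -m ≤ m := by linarith
  refine ⟨(intervalIntegrable_iff_integrableOn_Icc_of_le hle).1 (hI _ _), ?_⟩
  rw [integral_Icc_eq_integral_Ioc, ← intervalIntegral.integral_of_le hle,
    ← intervalIntegral.integral_add_adjacent_intervals (hI (-m) 0) (hI 0 m)]
  have h1 : ∫ s in (0 : ℝ)..m, |s| ^ β = m ^ (1 + β) / (1 + β) := by
    rw [intervalIntegral.integral_congr (g := fun s => s ^ β), integral_rpow (Or.inl hβ),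
      add_comm β, Real.zero_rpow (by linarith), sub_zero]
    intro s hs
    rw [Set.uIcc_of_le hm.le] at hs
    simp [abs_of_nonneg hs.1]
  have h2 : ∫ s in (-m)..0, |s| ^ β = ∫ s in (0 : ℝ)..m, |s| ^ β := by
    have := intervalIntegral.integral_comp_neg (fun s : ℝ => |s| ^ β) (a := 0) (b := m)
    simpa using this.symm
  rw [h2, h1]
  ring

theorem exists_integral_abs_rpow_mul_le {β : ℝ} (hβ : -1 < β) (hβ0 : β ≤ 0) :
    ∃ K : ℝ, 0 ≤ K ∧ ∀ (m c : ℝ), 0 < m →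
      Integrable (fun s : ℝ => |s| ^ β * (1 + ((c - s) / m) ^ 2)⁻¹) ∧
        ∫ s : ℝ, |s| ^ β * (1 + ((c - s) / m) ^ 2)⁻¹ ≤ K * m ^ (1 + β) := by
  have hβ1 : 0 < 1 + β := by linarith
  refine ⟨2 / (1 + β) + Real.pi, by positivity, fun m c hm => ?_⟩
  obtain ⟨i1, e1⟩ := integrableOn_abs_rpow hβ hm
  obtain ⟨i2, e2⟩ := integral_inv_one_add_sub_div_sq hm c
  rw [← integrable_indicator_iff measurableSet_Icc] at i1
  rw [← integral_indicator measurableSet_Icc] at e1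
  have hi := i1.add (i2.const_mul (m ^ β))
  have hbd : ∀ s : ℝ, |s| ^ β * (1 + ((c - s) / m) ^ 2)⁻¹ ≤
      (Set.Icc (-m) m).indicator (fun s : ℝ => |s| ^ β) s
        + m ^ β * (1 + ((c - s) / m) ^ 2)⁻¹ := by
    intro s
    by_cases hs : s ∈ Set.Icc (-m) m
    · rw [Set.indicator_of_mem hs]
      have : (1 + ((c - s) / m) ^ 2)⁻¹ ≤ 1 := inv_le_one_of_one_le₀ (by nlinarith [sq_nonneg ((c - s) / m)])
      have h3 : |s| ^ β * (1 + ((c - s) / m) ^ 2)⁻¹ ≤ |s| ^ β :=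
        mul_le_of_le_one_right (by positivity) this
      have h4 : 0 ≤ m ^ β * (1 + ((c - s) / m) ^ 2)⁻¹ := by positivity
      linarith
    · rw [Set.indicator_of_notMem hs, zero_add]
      have : m < |s| := by
        rwa [Set.mem_Icc, ← abs_le, not_le] at hs
      gcongr ?_ * _
      exact Real.rpow_le_rpow_of_nonpos hm this.le hβ0
  have hint : Integrable (fun s : ℝ => |s| ^ β * (1 + ((c - s) / m) ^ 2)⁻¹) := by
    refine hi.mono' (by fun_prop) (.of_forall fun s => ?_)
    rw [Real.norm_of_nonneg (by positivity)]
    exact hbd s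
  refine ⟨hint, (integral_mono hint hi hbd).trans (le_of_eq ?_)⟩
  rw [integral_add' i1 (i2.const_mul _), e1, integral_const_mul, e2, Real.rpow_add hm, Real.rpow_one]
  ring

theorem ae_snd_ne_zero : ∀ᵐ y : ℝ × ℝ, y.2 ≠ 0 :=
  Measure.quasiMeasurePreserving_snd.ae (Measure.ae_ne volume (0 : ℝ))

theorem pdist_nonneg (x y : ℝ × ℝ) : 0 ≤ pdist x y := by
  unfold pdist; positivity

theorem pdist_rpow_le {l : ℝ} (hl : 0 < l) {γ : ℝ} (hγ : 0 ≤ γ) (hγ2 : γ ≤ 2) (x y : ℝ × ℝ) :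
    pdist x y ^ γ ≤
      l ^ γ * (1 + (|(x.1 - y.1) / l| + √|(x.2 - y.2) / l ^ 2|)) ^ 2 := by
  have h : pdist x y = l * (|(x.1 - y.1) / l| + √|(x.2 - y.2) / l ^ 2|) := by
    rw [abs_div, abs_div, Real.sqrt_div (abs_nonneg _), abs_of_pos hl,
      abs_of_pos (pow_pos hl 2), Real.sqrt_sq hl.le, pdist]
    field_simp
  set d := |(x.1 - y.1) / l| + √|(x.2 - y.2) / l ^ 2|
  have hd : 0 ≤ d := by positivity
  rw [h, Real.mul_rpow hl.le hd]
  gcongr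
  calc d ^ γ ≤ (1 + d) ^ γ := by gcongr; linarith
    _ ≤ (1 + d) ^ (2 : ℝ) := by gcongr; linarith
    _ = (1 + d) ^ 2 := by norm_cast

/-- Schwartz kernels rescaled parabolically, integrated against a function bounded by a power of
the parabolic distance times a power of the time variable. -/
theorem SchwartzMap.exists_parabolic_integral_le (φ : SchwartzMap (ℝ × ℝ) ℝ) {β : ℝ}
    (hβ : -1 < β) (hβ0 : β ≤ 0) :
    ∃ K : ℝ, 0 ≤ K ∧ ∀ (l γ A : ℝ) (x : ℝ × ℝ) (H : ℝ × ℝ → ℝ), 0 < l → 0 ≤ γ → γ ≤ 2 → 0 ≤ A →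
      AEStronglyMeasurable H →
      (∀ y : ℝ × ℝ, y.2 ≠ 0 → |H y| ≤ A * pdist x y ^ γ * |y.2| ^ β) →
      Integrable (fun y => H y * φ ((x.1 - y.1) / l, (x.2 - y.2) / l ^ 2)) ∧
        |∫ y, H y * φ ((x.1 - y.1) / l, (x.2 - y.2) / l ^ 2)| ≤
          K * A * l ^ (γ + 3 + 2 * β) := by
  obtain ⟨M, hM0, hM⟩ := φ.exists_parabolic_decay
  obtain ⟨K, hK0, hK⟩ := exists_integral_abs_rpow_mul_le hβ hβ0
  refine ⟨M * Real.pi * K, by positivity, fun l γ A x H hl hγ hγ2 hA hH hb => ?_⟩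
  obtain ⟨i1, e1⟩ := integral_inv_one_add_sub_div_sq hl x.1
  obtain ⟨i2, e2⟩ := hK (l ^ 2) x.2 (by positivity)
  have hi := (i1.mul_prod i2).const_mul (A * l ^ γ * M)
  have hbd : ∀ᵐ y : ℝ × ℝ, ‖H y * φ ((x.1 - y.1) / l, (x.2 - y.2) / l ^ 2)‖ ≤
      A * l ^ γ * M * ((1 + ((x.1 - y.1) / l) ^ 2)⁻¹ *
        (|y.2| ^ β * (1 + ((x.2 - y.2) / l ^ 2) ^ 2)⁻¹)) := by
    filter_upwards [ae_snd_ne_zero] with y hy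
    rw [norm_mul, Real.norm_eq_abs, Real.norm_eq_abs]
    set z : ℝ × ℝ := ((x.1 - y.1) / l, (x.2 - y.2) / l ^ 2)
    calc |H y| * |φ z| ≤ (A * pdist x y ^ γ * |y.2| ^ β) * |φ z| := by
          gcongr; exact hb y hy
      _ ≤ (A * (l ^ γ * (1 + (|z.1| + √|z.2|)) ^ 2) * |y.2| ^ β) * |φ z| := by
          gcongr; exact pdist_rpow_le hl hγ hγ2 x y
      _ = A * l ^ γ * |y.2| ^ β * (|φ z| * (1 + (|z.1| + √|z.2|)) ^ 2) := by ring
      _ ≤ A * l ^ γ * |y.2| ^ β * (M * ((1 + z.1 ^ 2)⁻¹ * (1 + z.2 ^ 2)⁻¹)) := by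
          gcongr A * l ^ γ * |y.2| ^ β * ?_; exact hM z
      _ = _ := by ring
  refine ⟨hi.mono' (hH.mul (Continuous.aestronglyMeasurable (by fun_prop))) hbd, ?_⟩
  refine (norm_integral_le_of_norm_le hi hbd).trans ?_
  rw [integral_const_mul,
    integral_prod_mul (fun s : ℝ => (1 + ((x.1 - s) / l) ^ 2)⁻¹)
      (fun s : ℝ => |s| ^ β * (1 + ((x.2 - s) / l ^ 2) ^ 2)⁻¹), e1]
  calc A * l ^ γ * M * (l * Real.pi *
        ∫ s : ℝ, |s| ^ β * (1 + ((x.2 - s) / l ^ 2) ^ 2)⁻¹)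
      ≤ A * l ^ γ * M * (l * Real.pi * (K * (l ^ 2) ^ (1 + β))) := by gcongr
    _ = M * Real.pi * K * A * (l ^ γ * l * (l ^ 2) ^ (1 + β)) := by ring
    _ = _ := by
      congr 1
      rw [← Real.rpow_natCast l 2, ← Real.rpow_mul hl.le, ← Real.rpow_add_one hl.ne',
        ← Real.rpow_add hl]
      congr 1
      push_cast
      ring

theorem integral_comp_prod_mul {E : Type*} [NormedAddCommGroup E] [NormedSpace ℝ E]
    {a b : ℝ} (ha : 0 < a) (hb : 0 < b) (f : ℝ × ℝ → E) (hf : Continuous f) :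
    ∫ z : ℝ × ℝ, f (a * z.1, b * z.2) = (a * b)⁻¹ • ∫ z, f z := by
  have hmap : Measure.map (Prod.map (a * ·) (b * ·)) (volume : Measure (ℝ × ℝ)) =
      ENNReal.ofReal ((a * b)⁻¹) • volume := by
    rw [Measure.volume_eq_prod,
      ← Measure.map_prod_map _ _ (measurable_const_mul a) (measurable_const_mul b),
      Real.map_volume_mul_left ha.ne', Real.map_volume_mul_left hb.ne', Measure.prod_smul_left,
      Measure.prod_smul_right, smul_smul, ← ENNReal.ofReal_mul (abs_nonneg _), ← abs_mul,
      ← mul_inv, abs_of_pos (by positivity)]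
  have h := integral_map (μ := (volume : Measure (ℝ × ℝ))) (φ := Prod.map (a * ·) (b * ·))
    (f := f) (by fun_prop) hf.stronglyMeasurable.aestronglyMeasurable
  rw [hmap, integral_smul_measure, ENNReal.toReal_ofReal (by positivity)] at h
  exact h.symm

/-- A continuous integrable function on the plane with vanishing Fourier transform vanishes. -/
theorem eq_zero_of_fourier_integral_eq_zero {h : ℝ × ℝ → ℝ} (hc : Continuous h)
    (hi : Integrable h)
    (hF : ∀ k : ℝ × ℝ, ∫ x : ℝ × ℝ,
      Complex.exp (-(2 * Real.pi * (k.1 * x.1 + k.2 * x.2) : ℝ) * Complex.I) * (h x : ℂ) = 0) :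
    h = 0 := by
  let L : (ℝ × ℝ) →ₗ[ℝ] (ℝ × ℝ) →ₗ[ℝ] ℝ :=
    LinearMap.mk₂ ℝ (fun x k => -(2 * Real.pi) * (k.1 * x.1 + k.2 * x.2))
      (by intros; simp; ring) (by intros; simp; ring) (by intros; simp; ring)
      (by intros; simp; ring)
  have hLc : Continuous fun p : (ℝ × ℝ) × (ℝ × ℝ) => L p.1 p.2 := by
    simp only [L, LinearMap.mk₂_apply]; fun_prop
  have hL' : ∀ v : ℝ × ℝ, v ≠ 0 → L v ≠ 0 := by
    intro v hv h0
    have h1 : L v v = 0 := by rw [h0]; rfl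
    simp only [L, LinearMap.mk₂_apply, mul_eq_zero, neg_eq_zero, OfNat.ofNat_ne_zero,
      Real.pi_ne_zero, or_self, false_or] at h1
    apply hv
    ext
    · simp; nlinarith [mul_self_nonneg v.1, mul_self_nonneg v.2]
    · simp; nlinarith [mul_self_nonneg v.1, mul_self_nonneg v.2]
  have hfin (g : ℝ × ℝ → ℝ) (hg : Integrable g) :
      IsFiniteMeasure (volume.withDensity fun x => ENNReal.ofReal (g x)) :=
    isFiniteMeasure_withDensity_ofReal hg.hasFiniteIntegral
  have := hfin h hi
  have hineg : Integrable fun x => -h x := hi.neg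
  have := hfin _ hineg
  have hP : (volume.withDensity fun x => ENNReal.ofReal (h x)) =
      volume.withDensity fun x => ENNReal.ofReal (-h x) := by
    refine ext_of_integral_char_eq Real.continuous_probChar Real.probChar_ne_one hL' hLc
      fun k => ?_
    have key (x : ℝ × ℝ) : BoundedContinuousFunction.char Real.continuous_probChar hLc k x =
        Complex.exp (-(2 * Real.pi * (k.1 * x.1 + k.2 * x.2) : ℝ) * Complex.I) := by
      simp [BoundedContinuousFunction.char_apply, Real.probChar_apply, L]
    simp only [key]
    rw [integral_withDensity_eq_integral_toReal_smul (by fun_prop) (by simp),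
      integral_withDensity_eq_integral_toReal_smul (by fun_prop) (by simp), ← sub_eq_zero]
    have hint (g : ℝ × ℝ → ℝ) (hg : Integrable g) : Integrable fun x : ℝ × ℝ =>
        (ENNReal.ofReal (g x)).toReal •
          Complex.exp (-(2 * Real.pi * (k.1 * x.1 + k.2 * x.2) : ℝ) * Complex.I) := by
      have hpos : Integrable fun x : ℝ × ℝ => (ENNReal.ofReal (g x)).toReal := by
        simp only [ENNReal.toReal_ofReal']
        exact hg.pos_part
      simp only [Complex.real_smul]
      refine Integrable.mul_bdd (c := 1) hpos.ofReal
        (Continuous.aestronglyMeasurable (by fun_prop)) (.of_forall fun x => ?_)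
      rw [← Complex.ofReal_neg, Complex.norm_exp_ofReal_mul_I]
    have hintneg := hint (fun x => -h x) hineg
    rw [← integral_sub (hint h hi) hintneg, ← hF k]
    congr 1
    ext x
    rw [← sub_smul, ENNReal.toReal_ofReal', ENNReal.toReal_ofReal', Complex.real_smul, mul_comm]
    congr 2
    rcases le_total 0 (h x) with h0 | h0
    · simp [h0]
    · simp [h0]
  rw [withDensity_eq_iff_of_sigmaFinite (by fun_prop) (by fun_prop)] at hP
  refine Continuous.ae_eq_iff_eq volume hc continuous_zero |>.1 ?_
  filter_upwards [hP] with x hx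
  have := congrArg ENNReal.toReal hx
  rw [ENNReal.toReal_ofReal', ENNReal.toReal_ofReal'] at this
  rcases le_total 0 (h x) with h0 | h0 <;> simp_all

/-- The kernels of an `IsPsiKernel` family are the parabolic rescalings of the kernel at time 1. -/
theorem IsPsiKernel.scaling {ψ : ℝ → ℝ × ℝ → ℝ} (hψ : IsPsiKernel ψ) {l : ℝ} (hl : 0 < l)
    (z : ℝ × ℝ) : ψ (l ^ 4) z = (l ^ 3)⁻¹ * ψ 1 (z.1 / l, z.2 / l ^ 2) := by
  obtain ⟨hS, ⟨C, hC⟩, -⟩ := hψ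
  obtain ⟨φ, hφ⟩ := hS (l ^ 4) (by positivity)
  obtain ⟨φ₁, hφ₁⟩ := hS 1 one_pos
  let e : (ℝ × ℝ) ≃L[ℝ] ℝ × ℝ :=
    (ContinuousLinearEquiv.unitsEquivAut ℝ (Units.mk0 l⁻¹ (inv_ne_zero hl.ne'))).prodCongr
      (ContinuousLinearEquiv.unitsEquivAut ℝ (Units.mk0 (l ^ 2)⁻¹ (by positivity)))
  let χ : SchwartzMap (ℝ × ℝ) ℝ := φ - (l ^ 3)⁻¹ • SchwartzMap.compCLMOfContinuousLinearEquiv ℝ e φ₁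
  have he (x : ℝ × ℝ) : e x = (x.1 / l, x.2 / l ^ 2) := by
    simp [e, div_eq_mul_inv]
  have hχ (x : ℝ × ℝ) : χ x = ψ (l ^ 4) x - (l ^ 3)⁻¹ * ψ 1 (x.1 / l, x.2 / l ^ 2) := by
    simp [χ, hφ, hφ₁, he]
  have hz : (χ : ℝ × ℝ → ℝ) = 0 := by
    refine eq_zero_of_fourier_integral_eq_zero χ.continuous χ.integrable fun k => ?_
    have hexp (k : ℝ × ℝ) (g : SchwartzMap (ℝ × ℝ) ℝ) : Integrable fun x : ℝ × ℝ =>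
        Complex.exp (-(2 * Real.pi * (k.1 * x.1 + k.2 * x.2) : ℝ) * Complex.I) * (g x : ℂ) := by
      refine g.integrable.ofReal.bdd_mul (c := 1)
        (Continuous.aestronglyMeasurable (by fun_prop)) (.of_forall fun x => ?_)
      rw [← Complex.ofReal_neg, Complex.norm_exp_ofReal_mul_I]
    have h1 := hC (l ^ 4) (by positivity) k
    have h2 := hC 1 one_pos (l * k.1, l ^ 2 * k.2)
    have h3 := integral_comp_prod_mul (inv_pos.2 hl) (inv_pos.2 (pow_pos hl 2))
      (fun x : ℝ × ℝ => Complex.exp (-(2 * Real.pi * (l * k.1 * x.1 + l ^ 2 * k.2 * x.2) : ℝ) *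
        Complex.I) * (ψ 1 x : ℂ)) (by rw [hφ₁]; fun_prop)
    rw [h2] at h3
    have h4 : ∀ x : ℝ × ℝ,
        Complex.exp (-(2 * Real.pi * (k.1 * x.1 + k.2 * x.2) : ℝ) * Complex.I) * (χ x : ℂ) =
        Complex.exp (-(2 * Real.pi * (k.1 * x.1 + k.2 * x.2) : ℝ) * Complex.I) * (ψ (l ^ 4) x : ℂ)
        - ((l ^ 3)⁻¹ : ℝ) • (Complex.exp (-(2 * Real.pi * (l * k.1 * (l⁻¹ * x.1) +
          l ^ 2 * k.2 * ((l ^ 2)⁻¹ * x.2)) : ℝ) * Complex.I) *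
            (ψ 1 (l⁻¹ * x.1, (l ^ 2)⁻¹ * x.2) : ℂ)) := by
      intro x
      have e1 : l * k.1 * (l⁻¹ * x.1) = k.1 * x.1 := by field_simp
      have e2 : l ^ 2 * k.2 * ((l ^ 2)⁻¹ * x.2) = k.2 * x.2 := by field_simp
      rw [e1, e2, hχ, Complex.real_smul, div_eq_inv_mul, div_eq_inv_mul]
      push_cast
      ring
    have i1 := hexp k φ
    rw [← hφ] at i1
    have i2 : Integrable fun x : ℝ × ℝ => ((l ^ 3)⁻¹ : ℝ) • (Complex.exp (-(2 * Real.pi *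
        (l * k.1 * (l⁻¹ * x.1) + l ^ 2 * k.2 * ((l ^ 2)⁻¹ * x.2)) : ℝ) * Complex.I) *
            (ψ 1 (l⁻¹ * x.1, (l ^ 2)⁻¹ * x.2) : ℂ)) := by
      refine (i1.sub (hexp k χ)).congr (.of_forall fun x => ?_)
      simp only [Pi.sub_apply, h4 x]
      ring
    simp only [h4]
    rw [integral_sub i1 i2, integral_smul, h1, h3, smul_smul]
    have e3 : (l ^ 3)⁻¹ * (l⁻¹ * (l ^ 2)⁻¹)⁻¹ = 1 := by field_simp
    rw [e3, one_smul]
    have e4 : l ^ 4 * (k.1 ^ 4 + k.2 ^ 2) = 1 * ((l * k.1) ^ 4 + (l ^ 2 * k.2) ^ 2) := by ring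
    simp only [e4, sub_self]
  have := congrFun hz z
  rw [hχ] at this
  simpa [sub_eq_zero] using this

theorem continuous_of_pdist_le {F : ℝ × ℝ → ℝ} {A α : ℝ} (hα : 0 < α)
    (hF : ∀ x y : ℝ × ℝ, |F x - F y| ≤ A * pdist x y ^ α) : Continuous F := by
  refine continuous_iff_continuousAt.2 fun x => ?_
  refine tendsto_iff_norm_sub_tendsto_zero.2 ?_
  have h : Filter.Tendsto (fun y => A * pdist y x ^ α) (nhds x) (nhds 0) := by
    have hc : Continuous fun y => A * pdist y x ^ α := by
      unfold pdist
      exact continuous_const.mul (Continuous.rpow_const (by fun_prop) fun _ => Or.inr hα.le)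
    have := hc.tendsto x
    simpa [pdist, Real.zero_rpow hα.ne'] using this
  exact squeeze_zero (fun _ => norm_nonneg _) (fun y => hF y x) h

theorem aestronglyMeasurable_pd1 {g : ℝ × ℝ → ℝ} (hg : AEStronglyMeasurable g)
    (hd : ∀ x : ℝ × ℝ, x.2 ≠ 0 → DifferentiableAt ℝ (fun s : ℝ => g (s, x.2)) x.1) :
    AEStronglyMeasurable (pd1 g) := by
  let t : ℕ → ℝ := fun n => 1 / ((n : ℝ) + 1)
  have ht : ∀ n, t n ≠ 0 := fun n => (Nat.one_div_pos_of_nat).ne'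
  have ht0 : Filter.Tendsto t Filter.atTop (nhdsWithin 0 {0}ᶜ) :=
    tendsto_nhdsWithin_iff.2 ⟨tendsto_one_div_add_atTop_nhds_zero_nat, .of_forall ht⟩
  refine aestronglyMeasurable_of_tendsto_ae Filter.atTop
    (f := fun n x => (t n)⁻¹ • (g (x + (t n, 0)) - g x)) (fun n => ?_) ?_
  · have := hg.comp_measurePreserving (measurePreserving_add_right volume ((t n, 0) : ℝ × ℝ))
    exact AEStronglyMeasurable.const_smul (this.sub hg) (t n)⁻¹
  · filter_upwards [ae_snd_ne_zero] with x hx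
    have := ((hd x hx).hasDerivAt.tendsto_slope_zero).comp ht0
    convert this using 2 with n
    · simp [Prod.add_def]
    · rfl

/-- Integration by parts in the first variable. -/
theorem integral_mul_eq_neg_of_hasDerivAt_fst {u u' v v' : ℝ × ℝ → ℝ}
    (hu : ∀ y : ℝ × ℝ, y.2 ≠ 0 → HasDerivAt (fun s => u (s, y.2)) (u' y) y.1)
    (hv : ∀ y : ℝ × ℝ, HasDerivAt (fun s => v (s, y.2)) (v' y) y.1)
    (huv' : Integrable fun y => u y * v' y) (hu'v : Integrable fun y => u' y * v y)
    (huv : Integrable fun y => u y * v y) :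
    ∫ y, u y * v' y = -∫ y, u' y * v y := by
  rw [Measure.volume_eq_prod] at *
  rw [integral_prod_symm _ huv', integral_prod_symm _ hu'v, ← integral_neg]
  refine integral_congr_ae ?_
  filter_upwards [huv'.prod_left_ae, hu'v.prod_left_ae, huv.prod_left_ae,
    Measure.ae_ne volume (0 : ℝ)] with t h1 h2 h3 ht
  exact integral_mul_deriv_eq_deriv_mul_of_integrable (fun s _ => hu (s, t) ht)
    (fun s _ => hv (s, t)) h1 h2 h3

open scoped LineDeriv in
theorem SchwartzMap.hasDerivAt_fst (φ : SchwartzMap (ℝ × ℝ) ℝ) (s t : ℝ) :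
    HasDerivAt (fun s => φ (s, t)) ((∂_{((1, 0) : ℝ × ℝ)} φ) (s, t)) s := by
  have h := (φ.differentiableAt (x := (s, t))).hasFDerivAt.comp_hasDerivAt s
    ((hasDerivAt_id s).prodMk (hasDerivAt_const s t))
  rw [SchwartzMap.lineDerivOp_apply_eq_fderiv]
  exact h

theorem pd1_const_mul_comp_div {f f' : ℝ × ℝ → ℝ}
    (hf : ∀ s t : ℝ, HasDerivAt (fun s => f (s, t)) (f' (s, t)) s) (c l : ℝ) :
    pd1 (fun z => c * f (z.1 / l, z.2 / l ^ 2)) =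
      fun z => c / l * f' (z.1 / l, z.2 / l ^ 2) := by
  funext z
  have := ((hf (z.1 / l) (z.2 / l ^ 2)).comp z.1 ((hasDerivAt_id z.1).div_const l)).const_mul c
  refine this.deriv.trans ?_
  ring

open scoped LineDeriv in
/-- The kernels `ψ_T`, `∂₁ψ_T` and `∂₁²ψ_T` in terms of rescaled Schwartz functions. -/
theorem IsPsiKernel.exists_profiles {ψ : ℝ → ℝ × ℝ → ℝ} (hψ : IsPsiKernel ψ) :
    ∃ φ₀ φ₁ φ₂ : SchwartzMap (ℝ × ℝ) ℝ,
      (∀ s t : ℝ, HasDerivAt (fun s => φ₀ (s, t)) (φ₁ (s, t)) s) ∧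
      (∀ s t : ℝ, HasDerivAt (fun s => φ₁ (s, t)) (φ₂ (s, t)) s) ∧
      ∀ l : ℝ, 0 < l →
        ψ (l ^ 4) = (fun z => (l ^ 3)⁻¹ * φ₀ (z.1 / l, z.2 / l ^ 2)) ∧
        pd1 (ψ (l ^ 4)) = (fun z => (l ^ 4)⁻¹ * φ₁ (z.1 / l, z.2 / l ^ 2)) ∧
        pd1 (pd1 (ψ (l ^ 4))) = (fun z => (l ^ 5)⁻¹ * φ₂ (z.1 / l, z.2 / l ^ 2)) := by
  obtain ⟨φ, hφ⟩ := hψ.1 1 one_pos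
  refine ⟨φ, ∂_{((1, 0) : ℝ × ℝ)} φ, ∂_{((1, 0) : ℝ × ℝ)} (∂_{((1, 0) : ℝ × ℝ)} φ),
    φ.hasDerivAt_fst, SchwartzMap.hasDerivAt_fst _, fun l hl => ?_⟩
  have h0 : ψ (l ^ 4) = (fun z => (l ^ 3)⁻¹ * φ (z.1 / l, z.2 / l ^ 2)) := by
    funext z
    rw [hψ.scaling hl z, hφ]
  have h1 : pd1 (ψ (l ^ 4)) =
      fun z => (l ^ 4)⁻¹ * (∂_{((1, 0) : ℝ × ℝ)} φ) (z.1 / l, z.2 / l ^ 2) := by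
    rw [h0, pd1_const_mul_comp_div φ.hasDerivAt_fst]
    have e : (l ^ 3)⁻¹ / l = (l ^ 4)⁻¹ := by field_simp
    rw [e]
  refine ⟨h0, h1, ?_⟩
  rw [h1, pd1_const_mul_comp_div (SchwartzMap.hasDerivAt_fst _)]
  have e : (l ^ 4)⁻¹ / l = (l ^ 5)⁻¹ := by field_simp
  rw [e]

/-- The hypotheses on `G`: parabolic Hölder continuity, and two derivatives in `x₁` away from
`{x₂ = 0}` with the natural blow-up. -/
structure IsParabolicModel (α AG CG : ℝ) (G : ℝ × ℝ → ℝ) : Prop where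
  holder : ∀ x y : ℝ × ℝ, |G x - G y| ≤ AG * pdist x y ^ α
  differentiableAt : ∀ x : ℝ × ℝ, x.2 ≠ 0 → DifferentiableAt ℝ (fun s : ℝ => G (s, x.2)) x.1
  differentiableAt_pd1 : ∀ x : ℝ × ℝ, x.2 ≠ 0 →
    DifferentiableAt ℝ (fun s : ℝ => pd1 G (s, x.2)) x.1
  abs_pd1_le : ∀ x : ℝ × ℝ, x.2 ≠ 0 → |pd1 G x| ≤ CG * |x.2| ^ ((α - 1) / 2)
  abs_pd1_pd1_le : ∀ x : ℝ × ℝ, x.2 ≠ 0 → |pd1 (pd1 G) x| ≤ CG * |x.2| ^ ((α - 2) / 2)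

namespace IsParabolicModel

variable {α AG CG : ℝ} {G : ℝ × ℝ → ℝ}

theorem aestronglyMeasurable_pd1 (hG : IsParabolicModel α AG CG G) (hα : 0 < α) :
    AEStronglyMeasurable (pd1 G) :=
  _root_.aestronglyMeasurable_pd1 (continuous_of_pdist_le hα hG.holder).aestronglyMeasurable
    hG.differentiableAt

theorem aestronglyMeasurable_pd1_pd1 (hG : IsParabolicModel α AG CG G) (hα : 0 < α) :
    AEStronglyMeasurable (pd1 (pd1 G)) :=
  _root_.aestronglyMeasurable_pd1 (hG.aestronglyMeasurable_pd1 hα) hG.differentiableAt_pd1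

theorem nonneg (hG : IsParabolicModel α AG CG G) : 0 ≤ CG := by
  have := (abs_nonneg _).trans (hG.abs_pd1_le (0, 1) one_ne_zero)
  simpa using this

end IsParabolicModel

theorem nonneg_of_pdist_le {F : ℝ × ℝ → ℝ} {A α : ℝ}
    (hF : ∀ x y : ℝ × ℝ, |F x - F y| ≤ A * pdist x y ^ α) : 0 ≤ A := by
  have := (abs_nonneg _).trans (hF (1, 0) 0)
  simpa [pdist] using this

namespace SchwartzMap

variable (φ : SchwartzMap (ℝ × ℝ) ℝ) {H : ℝ × ℝ → ℝ}

theorem integrable_mul_rescaled {β A : ℝ} (hβ : -1 < β) (hβ0 : β ≤ 0) (hA : 0 ≤ A)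
    (hH : AEStronglyMeasurable H) (hb : ∀ y : ℝ × ℝ, y.2 ≠ 0 → |H y| ≤ A * |y.2| ^ β)
    {l : ℝ} (hl : 0 < l) (c : ℝ) (x : ℝ × ℝ) :
    Integrable fun y => H y * (c * φ ((x - y).1 / l, (x - y).2 / l ^ 2)) := by
  obtain ⟨K, -, hK⟩ := φ.exists_parabolic_integral_le hβ hβ0
  have h := (hK l 0 A x H hl le_rfl zero_le_two hA hH (by simpa using hb)).1.const_mul c
  refine h.congr (.of_forall fun y => ?_)
  simp only [Prod.fst_sub, Prod.snd_sub]
  ring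

theorem integrable_mul_holder_mul_rescaled {α A B : ℝ} {F G : ℝ × ℝ → ℝ} (hα : 0 < α)
    (hα1 : α < 1) (hF : Continuous F) (hB : ∀ y, |F y| ≤ B)
    (hG : ∀ x y : ℝ × ℝ, |G x - G y| ≤ A * pdist x y ^ α)
    {l : ℝ} (hl : 0 < l) (c : ℝ) (x : ℝ × ℝ) :
    Integrable fun y => F y * G y * (c * φ ((x - y).1 / l, (x - y).2 / l ^ 2)) := by
  have hGc := continuous_of_pdist_le hα hG
  have hB0 : 0 ≤ B := (abs_nonneg _).trans (hB 0)
  obtain ⟨K, -, hK⟩ := φ.exists_parabolic_integral_le (β := 0) (by norm_num) le_rfl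
  have h1 := (hK l α (B * A) x (fun y => F y * (G y - G x)) hl hα.le (by linarith)
    (mul_nonneg hB0 (nonneg_of_pdist_le hG)) (Continuous.aestronglyMeasurable (by fun_prop))
    (fun y _ => by
      rw [abs_mul, Real.rpow_zero, mul_one, mul_assoc, abs_sub_comm]
      exact mul_le_mul (hB y) (hG x y) (abs_nonneg _) hB0)).1.const_mul c
  have h2 := φ.integrable_mul_rescaled (H := F) (β := 0) (by norm_num) le_rfl hB0
    hF.aestronglyMeasurable (fun y _ => by simpa using hB y) hl (G x * c) x
  refine (h1.add h2).congr (.of_forall fun y => ?_)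
  simp only [Pi.add_apply, Prod.fst_sub, Prod.snd_sub]
  ring

end SchwartzMap

/-- Integrability of all integrands in `commT`. -/
structure CommIntegrable (ψ : ℝ → ℝ × ℝ → ℝ) (T : ℝ) (F G : ℝ × ℝ → ℝ) (x : ℝ × ℝ) : Prop where
  left : Integrable fun y => F y * pd1 (pd1 (ψ T)) (x - y)
  zero : Integrable fun y => (F y * G y) * pd1 (pd1 (ψ T)) (x - y)
  one : Integrable fun y => (F y * pd1 G y) * pd1 (ψ T) (x - y)
  two : Integrable fun y => (F y * pd1 (pd1 G) y) * ψ T (x - y)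

theorem commT_sub_sub_const {ψ : ℝ → ℝ × ℝ → ℝ} {T : ℝ} {F0 F1 G : ℝ × ℝ → ℝ} {x : ℝ × ℝ}
    (h0 : CommIntegrable ψ T F0 G x) (h1 : CommIntegrable ψ T F1 G x)
    (h : CommIntegrable ψ T (fun _ => 1) G x) (c : ℝ) :
    commT ψ T (fun y => F0 y - F1 y - c) G x =
      commT ψ T F0 G x - commT ψ T F1 G x - c * commT ψ T (fun _ => 1) G x := by
  have key : ∀ u v : ℝ × ℝ → ℝ, Integrable (fun y => F0 y * u y * v y) →
      Integrable (fun y => F1 y * u y * v y) → Integrable (fun y => 1 * u y * v y) →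
      ∫ y, (F0 y - F1 y - c) * u y * v y =
        (∫ y, F0 y * u y * v y) - (∫ y, F1 y * u y * v y) - c * ∫ y, 1 * u y * v y := by
    intro u v i0 i1 i
    rw [← integral_const_mul, ← integral_sub i0 i1, ← integral_sub (i0.sub' i1) (i.const_mul c)]
    congr 1
    ext y
    ring
  have e := key (fun _ => 1) (fun y => pd1 (pd1 (ψ T)) (x - y)) (by simpa using h0.left)
    (by simpa using h1.left) (by simpa using h.left)
  simp only [mul_one] at e
  simp only [commT]
  rw [e, key G _ h0.zero h1.zero h.zero, key (pd1 G) _ h0.one h1.one h.one,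
    key (pd1 (pd1 G)) _ h0.two h1.two h.two]
  ring

section

variable {α AG CG l : ℝ} {G : ℝ × ℝ → ℝ} {ψ : ℝ → ℝ × ℝ → ℝ}

theorem IsParabolicModel.commIntegrable (hG : IsParabolicModel α AG CG G) (hα : 0 < α)
    (hα1 : α < 1) (hψ : IsPsiKernel ψ) (hl : 0 < l) {F : ℝ × ℝ → ℝ} (hF : Continuous F) {B : ℝ}
    (hB : ∀ y, |F y| ≤ B) (x : ℝ × ℝ) : CommIntegrable ψ (l ^ 4) F G x := by
  obtain ⟨φ₀, φ₁, φ₂, -, -, hφ⟩ := hψ.exists_profiles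
  obtain ⟨e0, e1, e2⟩ := hφ l hl
  have hB0 : 0 ≤ B := (abs_nonneg _).trans (hB 0)
  have hCG := mul_nonneg hB0 hG.nonneg
  have hmul : ∀ {g : ℝ × ℝ → ℝ} {β : ℝ}, (∀ y : ℝ × ℝ, y.2 ≠ 0 → |g y| ≤ CG * |y.2| ^ β) →
      ∀ y : ℝ × ℝ, y.2 ≠ 0 → |F y * g y| ≤ B * CG * |y.2| ^ β := by
    intro g β hg y hy
    rw [abs_mul, mul_assoc]
    exact mul_le_mul (hB y) (hg y hy) (abs_nonneg _) hB0
  constructor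
  · rw [e2]
    exact φ₂.integrable_mul_rescaled (β := 0) (by norm_num) le_rfl hB0 hF.aestronglyMeasurable
      (fun y _ => by simpa using hB y) hl _ x
  · rw [e2]
    exact φ₂.integrable_mul_holder_mul_rescaled hα hα1 hF hB hG.holder hl _ x
  · rw [e1]
    exact φ₁.integrable_mul_rescaled (by linarith) (by linarith) hCG
      (hF.aestronglyMeasurable.mul (hG.aestronglyMeasurable_pd1 hα)) (hmul hG.abs_pd1_le) hl _ x
  · rw [e0]
    exact φ₀.integrable_mul_rescaled (by linarith) (by linarith) hCG
      (hF.aestronglyMeasurable.mul (hG.aestronglyMeasurable_pd1_pd1 hα))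
      (hmul hG.abs_pd1_pd1_le) hl _ x

/-- The renormalized commutator vanishes on constants. -/
theorem IsParabolicModel.commT_one (hG : IsParabolicModel α AG CG G) (hα : 0 < α)
    (hα1 : α < 1) (hψ : IsPsiKernel ψ) (hl : 0 < l) (x : ℝ × ℝ) :
    commT ψ (l ^ 4) (fun _ => 1) G x = 0 := by
  have hI := hG.commIntegrable hα hα1 hψ hl (F := fun _ => 1) continuous_const (B := 1)
    (by simp) x
  obtain ⟨i, i0, i1, i2⟩ := hI
  simp only [one_mul] at i0 i1 i2
  obtain ⟨φ₀, φ₁, φ₂, h01, h12, hφ⟩ := hψ.exists_profiles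
  obtain ⟨e0, e1, e2⟩ := hφ l hl
  have hder : ∀ {φ φ' : SchwartzMap (ℝ × ℝ) ℝ},
      (∀ s t : ℝ, HasDerivAt (fun s => φ (s, t)) (φ' (s, t)) s) → ∀ (c c' : ℝ), c / l = c' → ∀ y : ℝ × ℝ,
      HasDerivAt (fun s => c * φ ((x - (s, y.2)).1 / l, (x - (s, y.2)).2 / l ^ 2))
        (-(c' * φ' ((x - y).1 / l, (x - y).2 / l ^ 2))) y.1 := by
    rintro φ φ' h c - rfl y
    have := ((h ((x.1 - y.1) / l) ((x.2 - y.2) / l ^ 2)).comp y.1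
      (((hasDerivAt_id y.1).const_sub x.1).div_const l)).const_mul c
    refine this.congr_deriv ?_
    simp only [Prod.fst_sub, Prod.snd_sub]
    ring
  have d0 : ∀ y : ℝ × ℝ, HasDerivAt (fun s => ψ (l ^ 4) (x - (s, y.2)))
      (-pd1 (ψ (l ^ 4)) (x - y)) y.1 := by
    intro y
    rw [e1, e0]
    exact hder h01 _ _ (by field_simp) y
  have d1 : ∀ y : ℝ × ℝ, HasDerivAt (fun s => pd1 (ψ (l ^ 4)) (x - (s, y.2)))
      (-pd1 (pd1 (ψ (l ^ 4))) (x - y)) y.1 := by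
    intro y
    rw [e2, e1]
    exact hder h12 _ _ (by field_simp) y
  have j0 : Integrable fun y => pd1 (ψ (l ^ 4)) (x - y) := by
    rw [e1]
    simpa using φ₁.integrable_mul_rescaled (H := fun _ => 1) (A := 1) (β := 0) (by norm_num)
      le_rfl zero_le_one aestronglyMeasurable_const (by simp) hl (l ^ 4)⁻¹ x
  have j1 : Integrable fun y => G y * pd1 (ψ (l ^ 4)) (x - y) := by
    rw [e1]
    simpa using φ₁.integrable_mul_holder_mul_rescaled (F := fun _ => 1) hα hα1 continuous_const
      (B := 1) (by simp) hG.holder hl (l ^ 4)⁻¹ x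
  have j2 : Integrable fun y => pd1 G y * ψ (l ^ 4) (x - y) := by
    rw [e0]
    exact φ₀.integrable_mul_rescaled (by linarith) (by linarith) hG.nonneg
      (hG.aestronglyMeasurable_pd1 hα) hG.abs_pd1_le hl _ x
  have k0 := integral_mul_eq_neg_of_hasDerivAt_fst (u := fun _ => 1) (u' := fun _ => 0)
    (v' := fun y => -pd1 (pd1 (ψ (l ^ 4))) (x - y))
    (fun y _ => hasDerivAt_const _ _) d1 (by simpa using i.neg) (by simp) (by simpa using j0)
  have k1 := integral_mul_eq_neg_of_hasDerivAt_fst (u := G) (u' := pd1 G)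
    (fun y hy => (hG.differentiableAt y hy).hasDerivAt) d1 (by simpa using i0.neg) i1 j1
  have k2 := integral_mul_eq_neg_of_hasDerivAt_fst (u := pd1 G) (u' := pd1 (pd1 G))
    (fun y hy => (hG.differentiableAt_pd1 y hy).hasDerivAt) d0 (by simpa using i1.neg) i2 j2
  simp only [mul_neg, integral_neg, one_mul, zero_mul, integral_zero, neg_inj, neg_zero,
    neg_eq_zero] at k0 k1 k2
  simp only [commT, one_mul]
  rw [k0, k1, k2]
  ring

end

theorem IsPsiKernel.exists_abs_commT_le {ψ : ℝ → ℝ × ℝ → ℝ} (hψ : IsPsiKernel ψ)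
    {α : ℝ} (hα : 0 < α) (hα1 : α < 1) :
    ∃ C : ℝ, ∀ (f G : ℝ × ℝ → ℝ) (AG CG A B l : ℝ) (x : ℝ × ℝ), 0 < l →
      IsParabolicModel α AG CG G → Continuous f → (∀ y, |f y| ≤ B) → 0 ≤ A →
      (∀ y, |f y| ≤ A * pdist x y ^ α) →
      |commT ψ (l ^ 4) f G x| ≤ C * (CG + AG) * A * l ^ (2 * α - 2) := by
  obtain ⟨φ₀, φ₁, φ₂, -, -, hφ⟩ := hψ.exists_profiles
  obtain ⟨K0, hK0, h0⟩ := φ₀.exists_parabolic_integral_le (β := (α - 2) / 2) (by linarith)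
    (by linarith)
  obtain ⟨K1, hK1, h1⟩ := φ₁.exists_parabolic_integral_le (β := (α - 1) / 2) (by linarith)
    (by linarith)
  obtain ⟨K2, hK2, h2⟩ := φ₂.exists_parabolic_integral_le (β := 0) (by norm_num) le_rfl
  refine ⟨K0 + 2 * K1 + K2, fun f G AG CG A B l x hl hG hf hB hA hfA => ?_⟩
  obtain ⟨i, i0, -, -⟩ := hG.commIntegrable hα hα1 hψ hl hf hB x
  obtain ⟨e0, e1, e2⟩ := hφ l hl
  have hGc := continuous_of_pdist_le hα hG.holder
  have hAG := nonneg_of_pdist_le hG.holder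
  have hCG := hG.nonneg
  have hfm := hf.aestronglyMeasurable (μ := volume)
  have b2 := (h2 l (2 * α) (A * AG) x (fun y => f y * (G x - G y)) hl (by linarith)
    (by linarith) (by positivity) (Continuous.aestronglyMeasurable (by fun_prop))
    (fun y _ => by
      rw [abs_mul, Real.rpow_zero, mul_one, two_mul,
        Real.rpow_add_of_nonneg (pdist_nonneg x y) hα.le hα.le, mul_mul_mul_comm]
      exact mul_le_mul (hfA y) (hG.holder x y) (abs_nonneg _)
        (mul_nonneg hA (Real.rpow_nonneg (pdist_nonneg x y) _)))).2
  have hmul : ∀ {g : ℝ × ℝ → ℝ} {β : ℝ}, (∀ y : ℝ × ℝ, y.2 ≠ 0 → |g y| ≤ CG * |y.2| ^ β) →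
      ∀ y : ℝ × ℝ, y.2 ≠ 0 → |f y * g y| ≤ A * CG * pdist x y ^ α * |y.2| ^ β := by
    intro g β hg y hy
    rw [abs_mul, mul_right_comm A CG, mul_assoc (A * _)]
    exact mul_le_mul (hfA y) (hg y hy) (abs_nonneg _)
      (mul_nonneg hA (Real.rpow_nonneg (pdist_nonneg x y) _))
  have b1 := (h1 l α (A * CG) x (fun y => f y * pd1 G y) hl hα.le (by linarith) (by positivity)
    (hfm.mul (hG.aestronglyMeasurable_pd1 hα)) (hmul hG.abs_pd1_le)).2
  have b0 := (h0 l α (A * CG) x (fun y => f y * pd1 (pd1 G) y) hl hα.le (by linarith)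
    (by positivity) (hfm.mul (hG.aestronglyMeasurable_pd1_pd1 hα)) (hmul hG.abs_pd1_pd1_le)).2
  have hker : ∀ (c : ℝ) (u v : ℝ × ℝ → ℝ), ∫ y, u y * (c * v y) = c * ∫ y, u y * v y := by
    intro c u v
    rw [← integral_const_mul]
    congr 1
    ext y
    ring
  have hpow : ∀ (n : ℕ) (p : ℝ), p - n = 2 * α - 2 → (l ^ n)⁻¹ * l ^ p = l ^ (2 * α - 2) := by
    intro n p hp
    rw [← hp, Real.rpow_sub hl, Real.rpow_natCast, div_eq_inv_mul]
  have c2 : |G x * (∫ y, f y * pd1 (pd1 (ψ (l ^ 4))) (x - y)) -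
      ∫ y, f y * G y * pd1 (pd1 (ψ (l ^ 4))) (x - y)| ≤ K2 * (A * AG) * l ^ (2 * α - 2) := by
    rw [← integral_const_mul, ← integral_sub (i.const_mul _) i0, e2]
    rw [show (fun y => G x * (f y * ((l ^ 5)⁻¹ * φ₂ ((x - y).1 / l, (x - y).2 / l ^ 2))) -
        f y * G y * ((l ^ 5)⁻¹ * φ₂ ((x - y).1 / l, (x - y).2 / l ^ 2))) =
        fun y => f y * (G x - G y) * ((l ^ 5)⁻¹ * φ₂ ((x - y).1 / l, (x - y).2 / l ^ 2)) by
      ext y; ring]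
    rw [hker, abs_mul, abs_of_pos (by positivity), ← hpow 5 (2 * α + 3 + 2 * 0)
      (by push_cast; ring), mul_left_comm]
    exact mul_le_mul_of_nonneg_left b2 (by positivity)
  have c1 : |∫ y, f y * pd1 G y * pd1 (ψ (l ^ 4)) (x - y)| ≤
      K1 * (A * CG) * l ^ (2 * α - 2) := by
    rw [e1, hker, abs_mul, abs_of_pos (by positivity), ← hpow 4 (α + 3 + 2 * ((α - 1) / 2))
      (by push_cast; ring), mul_left_comm]
    exact mul_le_mul_of_nonneg_left b1 (by positivity)
  have c0 : |∫ y, f y * pd1 (pd1 G) y * ψ (l ^ 4) (x - y)| ≤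
      K0 * (A * CG) * l ^ (2 * α - 2) := by
    rw [e0, hker, abs_mul, abs_of_pos (by positivity), ← hpow 3 (α + 3 + 2 * ((α - 2) / 2))
      (by push_cast; ring), mul_left_comm]
    exact mul_le_mul_of_nonneg_left b0 (by positivity)
  set L := l ^ (2 * α - 2)
  have hL : 0 ≤ L := by positivity
  have r0 : 0 ≤ K0 * AG * A * L := by positivity
  have r1 : 0 ≤ K1 * AG * A * L := by positivity
  have r2 : 0 ≤ K2 * CG * A * L := by positivity
  rw [commT]
  rw [abs_le] at *
  constructor <;> linarith

/-- continuity of the generalized product `G ◊ ∂₁²F` in `F`. -/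
theorem generalized_product_continuity_in_F
    (ψ : ℝ → ℝ × ℝ → ℝ) (hψ : IsPsiKernel ψ)
    (α : ℝ) (hα : 0 < α) (hα1 : α < 1) :
    ∃ C : ℝ, ∀ (G F0 F1 : ℝ × ℝ → ℝ) (AG CG BF0 BF1 AF0 AF1 AD : ℝ),
      (∀ x y : ℝ × ℝ, |G x - G y| ≤ AG * pdist x y ^ α) →
      (∀ x : ℝ × ℝ, x.2 ≠ 0 → DifferentiableAt ℝ (fun s : ℝ => G (s, x.2)) x.1) →
      (∀ x : ℝ × ℝ, x.2 ≠ 0 → DifferentiableAt ℝ (fun s : ℝ => pd1 G (s, x.2)) x.1) →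
      (∀ x : ℝ × ℝ, x.2 ≠ 0 → |pd1 G x| ≤ CG * |x.2| ^ ((α - 1) / 2)) →
      (∀ x : ℝ × ℝ, x.2 ≠ 0 → |pd1 (pd1 G) x| ≤ CG * |x.2| ^ ((α - 2) / 2)) →
      (∀ x : ℝ × ℝ, |F0 x| ≤ BF0) →
      (∀ x : ℝ × ℝ, |F1 x| ≤ BF1) →
      (∀ x y : ℝ × ℝ, |F0 x - F0 y| ≤ AF0 * pdist x y ^ α) →
      (∀ x y : ℝ × ℝ, |F1 x - F1 y| ≤ AF1 * pdist x y ^ α) →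
      (∀ x y : ℝ × ℝ, |(F0 x - F1 x) - (F0 y - F1 y)| ≤ AD * pdist x y ^ α) →
      ∀ T : ℝ, 0 < T → T ≤ 1 → ∀ x : ℝ × ℝ,
        |commT ψ T F0 G x - commT ψ T F1 G x|
          ≤ C * (CG + AG) * AD * T ^ ((2 * α - 2) / 4) := by
  obtain ⟨C, hC⟩ := hψ.exists_abs_commT_le hα hα1
  refine ⟨C, fun G F0 F1 AG CG BF0 BF1 AF0 AF1 AD hG hd hd' h1 h2 hB0 hB1 hF0 hF1 hD T hT _ x => ?_⟩
  have hM : IsParabolicModel α AG CG G := ⟨hG, hd, hd', h1, h2⟩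
  have hl : 0 < T ^ (1 / 4 : ℝ) := by positivity
  have hT4 : T = (T ^ (1 / 4 : ℝ)) ^ 4 := by
    rw [← Real.rpow_mul_natCast hT.le]
    norm_num
  have hTp : T ^ ((2 * α - 2) / 4) = (T ^ (1 / 4 : ℝ)) ^ (2 * α - 2) := by
    rw [← Real.rpow_mul hT.le]
    congr 1
    ring
  rw [hTp]
  set l := T ^ (1 / 4 : ℝ)
  rw [hT4]
  have hc0 := continuous_of_pdist_le hα hF0
  have hc1 := continuous_of_pdist_le hα hF1
  have hsub := commT_sub_sub_const (hM.commIntegrable hα hα1 hψ hl hc0 hB0 x)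
    (hM.commIntegrable hα hα1 hψ hl hc1 hB1 x)
    (hM.commIntegrable hα hα1 hψ hl (F := fun _ => 1) continuous_const (B := 1) (by simp) x)
    (F0 x - F1 x)
  rw [hM.commT_one hα hα1 hψ hl x, mul_zero, sub_zero] at hsub
  rw [← hsub]
  refine hC _ G AG CG AD (BF0 + BF1 + |F0 x - F1 x|) l x hl hM (by fun_prop) (fun y => ?_)
    (nonneg_of_pdist_le (F := fun y => F0 y - F1 y) hD) (fun y => ?_)
  · have e1 := abs_sub (F0 y - F1 y) (F0 x - F1 x)
    have e2 := abs_sub (F0 y) (F1 y)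
    linarith [hB0 y, hB1 y]
  · rw [abs_sub_comm]
    exact hD x y
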